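/- Let u ∈ (−1, 1) and μ ∈ (−1−u, 0), and for m ∈ ℤ let v_{2m}^{(u)}(x) = (1+x²)^{−(1+u)/2} ((1+xi)/(1−xi))^m. Then there exists a constant c_{μ,u} > 0 such that for all m ∈ ℤ: ⫴v_{2m}^{(u)}⫴²_{u+μ} := ∫₀^{2π} ∫_ℝ |ξ|^{−u−μ} |𝓕(π_{u,+}(k_{θ₀}) v_{2m}^{(u)})(ξ)|² dξ dθ₀ ≤ c_{μ,u} (1+|m|)^{−u−μ} (the inner improper Fourier transforms existing for all ξ ≠ 0). -/

import Mathlib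

open MeasureTheory Real Set Filter Complex
open scoped ENNReal NNReal

noncomputable section

/-- The weight-`2m` K-type vector `v_{2m}^{(u)}(x) = (1+x²)^{−(1+u)/2} ((1+xi)/(1−xi))^m`
of the principal series `P(u,+)` in the noncompact picture. -/
def vEven (u : ℂ) (m : ℤ) (x : ℝ) : ℂ :=
  ((1 + x ^ 2 : ℝ) : ℂ) ^ (-(1 + u) / 2) *
    ((1 + (x : ℂ) * Complex.I) / (1 - (x : ℂ) * Complex.I)) ^ m

/-- `z` is the improper Fourier transform of `g` at `ξ`:
`z = lim_{R→∞} ∫_{−R}^R g(x) e^{−2πixξ} dx`. -/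
def IsImpFT (g : ℝ → ℂ) (ξ : ℝ) (z : ℂ) : Prop :=
  Filter.Tendsto
    (fun R : ℝ => ∫ x in Set.Ioc (-R) R,
      g x * Complex.exp (-2 * (Real.pi : ℂ) * Complex.I * (x : ℂ) * (ξ : ℂ)))
    Filter.atTop (nhds z)

/-- The principal-series rotation action
`(π_{s,+}(k_θ)v)(x) = |cos θ − x sin θ|^{−1−s} v((x cos θ + sin θ)/(cos θ − x sin θ))`. -/
def piPlus (s : ℂ) (θ : ℝ) (v : ℝ → ℂ) (x : ℝ) : ℂ :=
  ((|Real.cos θ - x * Real.sin θ| : ℝ) : ℂ) ^ (-1 - s) *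
    v ((x * Real.cos θ + Real.sin θ) / (Real.cos θ - x * Real.sin θ))

/-- The nonspherical principal-series rotation action, with the sign factor
`sgn(cos θ − x sin θ)`. -/
def piMinus (s : ℂ) (θ : ℝ) (v : ℝ → ℂ) (x : ℝ) : ℂ :=
  ((Real.sign (Real.cos θ - x * Real.sin θ) : ℝ) : ℂ) *
    ((|Real.cos θ - x * Real.sin θ| : ℝ) : ℂ) ^ (-1 - s) *
    v ((x * Real.cos θ + Real.sin θ) / (Real.cos θ - x * Real.sin θ))

/-- `arccot x = π/2 − arctan x ∈ (0, π)`. -/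
def arccot (x : ℝ) : ℝ := Real.pi / 2 - Real.arctan x

section Plancherel

open scoped FourierTransform SchwartzMap ContDiff

/-- The `L²` Fourier transform of an integrable, square-integrable function is given by the
Fourier integral. -/
theorem fourier_toLp_ae_eq {f : ℝ → ℂ} (hf₁ : Integrable f) (hf₂ : MemLp f 2) :
    (𝓕 (hf₂.toLp f) : Lp ℂ 2 (volume : Measure ℝ)) =ᵐ[volume] 𝓕 f := by
  apply ae_eq_of_integral_contDiff_smul_eq
  · exact (Lp.memLp _).locallyIntegrable (by norm_num)
  · refine Continuous.locallyIntegrable ?_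
    exact VectorFourier.fourierIntegral_continuous Real.continuous_fourierChar
      continuous_inner hf₁
  · intro g hg hgs
    have hgc : HasCompactSupport (fun x => (g x : ℂ)) :=
      hgs.comp_left (g := fun t : ℝ => (t : ℂ)) (by simp)
    have hgd : ContDiff ℝ ∞ (fun x => (g x : ℂ)) := Complex.ofRealCLM.contDiff.comp hg
    set G : 𝓢(ℝ, ℂ) := hgc.toSchwartzMap hgd with hG
    have key := Lp.fourier_toTemperedDistribution_eq (hf₂.toLp f)
    have := congrArg (fun T => T G) key
    simp only [TemperedDistribution.fourier_apply, Lp.toTemperedDistribution_apply] at this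
    have h2 : ∫ x, (𝓕 G) x • (hf₂.toLp f) x = ∫ x, (𝓕 G) x • f x :=
      integral_congr_ae (by filter_upwards [hf₂.coeFn_toLp] with x hx; rw [hx])
    have h3 : ∫ x, (𝓕 G) x • f x = ∫ x, G x • 𝓕 f x := by
      have := VectorFourier.integral_fourierIntegral_smul_eq_flip (e := Real.fourierChar)
        (L := innerₗ ℝ) (μ := volume) (ν := volume) Real.continuous_fourierChar
        continuous_inner G.integrable hf₁
      simpa [SchwartzMap.fourier_coe, flip_innerₗ] using! this
    have hGx : ∀ x, G x = (g x : ℂ) := fun x => rfl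
    rw [h2, h3] at this
    simpa [hGx] using! this.symm

theorem lintegral_enorm_sq_fourier_eq {f : ℝ → ℂ} (hf₁ : Integrable f) (hf₂ : MemLp f 2) :
    ∫⁻ ξ, ‖𝓕 f ξ‖ₑ ^ 2 = ∫⁻ x, ‖f x‖ₑ ^ 2 := by
  have hn := congrArg ENNReal.ofReal (Lp.norm_fourier_eq (hf₂.toLp f))
  have h1 : eLpNorm (𝓕 f) 2 volume = eLpNorm f 2 volume := by
    rw [← eLpNorm_congr_ae (fourier_toLp_ae_eq hf₁ hf₂), ← eLpNorm_congr_ae hf₂.coeFn_toLp]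
    simpa [Lp.norm_def, ENNReal.ofReal_toReal, Lp.eLpNorm_ne_top] using hn
  have h2 : ∀ h : ℝ → ℂ, ∫⁻ x, ‖h x‖ₑ ^ 2 = eLpNorm h 2 volume ^ 2 := by
    intro h
    have := eLpNorm_nnreal_pow_eq_lintegral (f := h) (μ := volume) (p := 2) (by norm_num)
    simpa using this.symm
  rw [h2, h2, h1]

end Plancherel

theorem one_sub_mul_I_ne_zero (x : ℝ) : (1 - (x : ℂ) * Complex.I) ≠ 0 := by
  intro h; simpa using congrArg Complex.re h

/-- The Cayley transform of `x` is `e^{2i arctan x}`. -/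
theorem cayley_eq_exp (x : ℝ) :
    (1 + (x : ℂ) * Complex.I) / (1 - (x : ℂ) * Complex.I) =
      cexp ((2 * Real.arctan x : ℝ) * Complex.I) := by
  have h0 : 0 < √(1 + x ^ 2) := Real.sqrt_pos.2 (by positivity)
  have hc : ∀ t : ℝ, cexp ((t : ℂ) * Complex.I) = (Real.cos t : ℂ) + Real.sin t * Complex.I := by
    intro t; rw [Complex.exp_mul_I]; simp
  have hs : (√(1 + x ^ 2) : ℂ) ≠ 0 := by exact_mod_cast h0.ne'
  have h1 : cexp ((Real.arctan x : ℝ) * Complex.I) = (1 + x * Complex.I) / (√(1 + x ^ 2) : ℂ) := by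
    rw [hc, Real.cos_arctan, Real.sin_arctan]; push_cast; field_simp
  have h2 : cexp (-((Real.arctan x : ℝ) * Complex.I)) =
      (1 - x * Complex.I) / (√(1 + x ^ 2) : ℂ) := by
    have := hc (-Real.arctan x)
    rw [Real.cos_neg, Real.sin_neg, Real.cos_arctan, Real.sin_arctan] at this
    simp only [Complex.ofReal_neg, Complex.ofReal_div, Complex.ofReal_one, neg_mul] at this
    rw [this]; field_simp; ring
  have h3 : ((2 * Real.arctan x : ℝ) : ℂ) * Complex.I =
      (Real.arctan x : ℝ) * Complex.I - -((Real.arctan x : ℝ) * Complex.I) := by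
    push_cast; ring
  have := one_sub_mul_I_ne_zero x
  rw [h3, Complex.exp_sub, h1, h2]
  field_simp

theorem vEven_eq (u : ℝ) (m : ℤ) (x : ℝ) :
    vEven u m x =
      (((1 + x ^ 2) ^ (-(1 + u) / 2) : ℝ) : ℂ) * cexp ((2 * m * Real.arctan x : ℝ) * Complex.I) := by
  rw [vEven, cayley_eq_exp, ← Complex.exp_int_mul, Complex.ofReal_cpow (by positivity)]
  congr 2
  · push_cast; rfl
  · push_cast; ring

theorem piPlus_vEven (u θ : ℝ) (m : ℤ) {x : ℝ} (hx : Real.cos θ - x * Real.sin θ ≠ 0) :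
    piPlus u θ (vEven u m) x = cexp ((2 * m * θ : ℝ) * Complex.I) * vEven u m x := by
  set D := Real.cos θ - x * Real.sin θ with hD
  set N := x * Real.cos θ + Real.sin θ with hN
  have hsum : 1 + (N / D) ^ 2 = (1 + x ^ 2) * (|D| ^ 2)⁻¹ := by
    rw [sq_abs]; field_simp
    rw [hD, hN]; linear_combination (1 + x ^ 2) * Real.sin_sq_add_cos_sq θ
  have habs : 0 < |D| := abs_pos.2 hx
  have hmod : |D| ^ (-1 - u) * (1 + (N / D) ^ 2) ^ (-(1 + u) / 2) =
      (1 + x ^ 2) ^ (-(1 + u) / 2) := by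
    rw [hsum, Real.mul_rpow (by positivity) (by positivity), Real.inv_rpow (by positivity),
      ← Real.rpow_natCast |D| 2, ← Real.rpow_mul habs.le, ← Real.rpow_neg habs.le,
      mul_left_comm, ← Real.rpow_add habs]
    have : -1 - u + -(((2 : ℕ) : ℝ) * (-(1 + u) / 2)) = 0 := by push_cast; ring
    rw [this, Real.rpow_zero, mul_one]
  have hDc : (D : ℂ) ≠ 0 := by exact_mod_cast hx
  have hcay : (1 + ((N / D : ℝ) : ℂ) * Complex.I) / (1 - ((N / D : ℝ) : ℂ) * Complex.I) =
      cexp ((2 * θ : ℝ) * Complex.I) * ((1 + (x : ℂ) * Complex.I) / (1 - (x : ℂ) * Complex.I)) := by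
    have e1 : (D : ℂ) + N * Complex.I = cexp (θ * Complex.I) * (1 + x * Complex.I) := by
      rw [Complex.exp_mul_I, hD, hN]; push_cast
      linear_combination (-(x : ℂ) * Complex.sin θ) * Complex.I_sq
    have e2 : (D : ℂ) - N * Complex.I = cexp (-(θ * Complex.I)) * (1 - x * Complex.I) := by
      rw [← neg_mul, Complex.exp_mul_I, hD, hN, Complex.cos_neg, Complex.sin_neg]; push_cast
      linear_combination (-(x : ℂ) * Complex.sin θ) * Complex.I_sq
    have e3 : (1 + ((N / D : ℝ) : ℂ) * Complex.I) / (1 - ((N / D : ℝ) : ℂ) * Complex.I) =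
        ((D : ℂ) + N * Complex.I) / ((D : ℂ) - N * Complex.I) := by
      have hn : (D : ℂ) - N * Complex.I ≠ 0 := by
        rw [e2]; exact mul_ne_zero (Complex.exp_ne_zero _) (one_sub_mul_I_ne_zero x)
      have := one_sub_mul_I_ne_zero (N / D)
      rw [div_eq_div_iff this hn]; push_cast; field_simp
    rw [e3, e1, e2, mul_div_mul_comm, ← Complex.exp_sub]
    congr 2; push_cast; ring
  have hpow : cexp ((2 * m * θ : ℝ) * Complex.I) = cexp ((2 * θ : ℝ) * Complex.I) ^ m := by
    rw [← Complex.exp_int_mul]; congr 1; push_cast; ring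
  rw [piPlus, ← hD, ← hN, vEven, vEven, hcay, mul_zpow, hpow]
  have hmod' := congrArg (fun r : ℝ => (r : ℂ)) hmod
  simp only [Complex.ofReal_mul] at hmod'
  rw [Complex.ofReal_cpow habs.le, Complex.ofReal_cpow (by positivity),
    Complex.ofReal_cpow (by positivity)] at hmod'
  have hexp₁ : ((-1 - u : ℝ) : ℂ) = -1 - u := by push_cast; rfl
  have hexp₂ : ((-(1 + u) / 2 : ℝ) : ℂ) = -(1 + u) / 2 := by push_cast; rfl
  rw [hexp₁, hexp₂] at hmod'
  rw [← mul_assoc, hmod']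
  ring

theorem IsImpFT.congr_ae {g h : ℝ → ℂ} {ξ : ℝ} {z : ℂ} (hg : IsImpFT g ξ z)
    (hgh : h =ᵐ[volume] g) : IsImpFT h ξ z := by
  refine Tendsto.congr (fun R => ?_) hg
  refine integral_congr_ae (ae_restrict_of_ae ?_)
  filter_upwards [hgh] with x hx
  rw [hx]

theorem IsImpFT.const_mul {g : ℝ → ℂ} {ξ : ℝ} {z : ℂ} (hg : IsImpFT g ξ z) (c : ℂ) :
    IsImpFT (fun x => c * g x) ξ (c * z) := by
  refine Tendsto.congr (fun R => ?_) (Tendsto.const_mul c hg)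
  rw [← integral_const_mul]
  simp only [mul_assoc]

theorem piPlus_vEven_ae (u θ : ℝ) (m : ℤ) :
    piPlus u θ (vEven u m) =ᵐ[volume]
      fun x => cexp ((2 * m * θ : ℝ) * Complex.I) * vEven u m x := by
  have hsub : {x : ℝ | Real.cos θ - x * Real.sin θ = 0} ⊆ {Real.cos θ / Real.sin θ} := by
    intro x hx
    simp only [mem_ofPred_eq] at hx
    have hs : Real.sin θ ≠ 0 := by
      intro h
      have := Real.sin_sq_add_cos_sq θ
      rw [h, mul_zero, sub_zero] at hx
      rw [h, hx] at this
      norm_num at this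
    rw [mem_singleton_iff, eq_div_iff hs]; linarith
  have : ∀ᵐ x : ℝ, Real.cos θ - x * Real.sin θ ≠ 0 :=
    measure_mono_null (by simpa using hsub) (measure_singleton _)
  filter_upwards [this] with x hx using piPlus_vEven u θ m hx

/-- The derivative of `vEven u m`. -/
def vEvenDeriv (u : ℝ) (m : ℤ) (x : ℝ) : ℂ :=
  ((2 * m * Complex.I - (1 + u) * x) / (1 + (x : ℂ) ^ 2)) * vEven u m x

theorem one_add_ofReal_sq_ne_zero (x : ℝ) : (1 + (x : ℂ) ^ 2) ≠ 0 := by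
  have : (1 + x ^ 2 : ℝ) ≠ 0 := by positivity
  exact_mod_cast this

theorem hasDerivAt_one_add_sq_rpow (p x : ℝ) :
    HasDerivAt (fun x : ℝ => (1 + x ^ 2) ^ p) (2 * x * p * (1 + x ^ 2) ^ (p - 1)) x := by
  have h : HasDerivAt (fun x : ℝ => 1 + x ^ 2) (2 * x) x := by
    simpa using (hasDerivAt_pow 2 x).const_add 1
  exact h.rpow_const (Or.inl (by positivity))

theorem hasDerivAt_vEven (u : ℝ) (m : ℤ) (x : ℝ) :
    HasDerivAt (vEven u m) (vEvenDeriv u m x) x := by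
  have h1 := (hasDerivAt_one_add_sq_rpow (-(1 + u) / 2) x).ofReal_comp
  have h2 : HasDerivAt (fun x : ℝ => (2 * m * Real.arctan x : ℝ))
      (2 * m * (1 / (1 + x ^ 2))) x := (Real.hasDerivAt_arctan x).const_mul _
  have h3 := (h2.ofReal_comp.mul_const Complex.I).cexp
  have h4 := h1.mul h3
  have heq : vEven u m = fun x : ℝ => (((1 + x ^ 2) ^ (-(1 + u) / 2) : ℝ) : ℂ) *
      cexp ((2 * m * Real.arctan x : ℝ) * Complex.I) := funext (vEven_eq u m)
  have hy : (0 : ℝ) < 1 + x ^ 2 := by positivity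
  have hyc := one_add_ofReal_sq_ne_zero x
  rw [vEvenDeriv, vEven_eq, heq]
  convert! h4 using 1
  rw [Real.rpow_sub_one hy.ne']
  push_cast
  field_simp
  ring

theorem continuous_vEven (u : ℝ) (m : ℤ) : Continuous (vEven u m) :=
  continuous_iff_continuousAt.2 fun x => (hasDerivAt_vEven u m x).continuousAt

theorem continuous_vEvenDeriv (u : ℝ) (m : ℤ) : Continuous (vEvenDeriv u m) := by
  refine Continuous.mul (Continuous.div ?_ ?_ one_add_ofReal_sq_ne_zero) (continuous_vEven u m)
  · fun_prop
  · fun_prop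

theorem norm_vEven (u : ℝ) (m : ℤ) (x : ℝ) : ‖vEven u m x‖ = (1 + x ^ 2) ^ (-(1 + u) / 2) := by
  rw [vEven_eq, norm_mul, Complex.norm_exp_ofReal_mul_I, mul_one, Complex.norm_real,
    Real.norm_of_nonneg (by positivity)]

theorem norm_vEvenDeriv_le {u : ℝ} (hu : u ∈ Ioo (-1 : ℝ) 1) (m : ℤ) (x : ℝ) :
    ‖vEvenDeriv u m x‖ ≤ 2 * (1 + |(m : ℝ)|) * (1 + x ^ 2) ^ (-(2 + u) / 2) := by
  have hy : (0 : ℝ) < 1 + x ^ 2 := by positivity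
  have hden : ‖(1 + (x : ℂ) ^ 2)‖ = 1 + x ^ 2 := by
    have : (1 + (x : ℂ) ^ 2) = ((1 + x ^ 2 : ℝ) : ℂ) := by push_cast; rfl
    rw [this, Complex.norm_real, Real.norm_of_nonneg hy.le]
  have hroot : (1 + x ^ 2) ^ (1 / 2 : ℝ) = √(1 + x ^ 2) := (Real.sqrt_eq_rpow _).symm
  have h1 : (1 : ℝ) ≤ √(1 + x ^ 2) := Real.one_le_sqrt.2 (by nlinarith)
  have h2 : |x| ≤ √(1 + x ^ 2) := Real.abs_le_sqrt (by linarith)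
  have hnum : ‖(2 * m * Complex.I - (1 + u) * x : ℂ)‖ ≤ 2 * (1 + |(m : ℝ)|) * √(1 + x ^ 2) := by
    have hu' : ‖(1 + u : ℂ)‖ ≤ 2 := by
      have : (1 + u : ℂ) = ((1 + u : ℝ) : ℂ) := by push_cast; rfl
      rw [this, Complex.norm_real, Real.norm_of_nonneg (by linarith [hu.1])]
      linarith [hu.2]
    have hm : ‖(2 * m * Complex.I : ℂ)‖ = 2 * |(m : ℝ)| := by
      simp
    calc ‖(2 * m * Complex.I - (1 + u) * x : ℂ)‖
        ≤ ‖(2 * m * Complex.I : ℂ)‖ + ‖((1 + u) * x : ℂ)‖ := norm_sub_le _ _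
      _ ≤ 2 * |(m : ℝ)| + 2 * |x| := by
          rw [hm, norm_mul, Complex.norm_real, Real.norm_eq_abs]
          gcongr
      _ ≤ _ := by nlinarith [abs_nonneg (m : ℝ), abs_nonneg x]
  have hpow : (1 + x ^ 2) ^ (-(2 + u) / 2) =
      √(1 + x ^ 2) / (1 + x ^ 2) * (1 + x ^ 2) ^ (-(1 + u) / 2) := by
    rw [← hroot, ← Real.rpow_sub_one hy.ne', ← Real.rpow_add hy]
    congr 1; ring
  rw [vEvenDeriv, norm_mul, norm_div, hden, norm_vEven, hpow, ← mul_assoc, ← mul_div_assoc]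
  gcongr

theorem integrable_one_add_sq_rpow {r : ℝ} (hr : 1 < r) :
    Integrable (fun x : ℝ => (1 + x ^ 2) ^ (-r / 2)) := by
  simpa using integrable_rpow_neg_one_add_norm_sq (E := ℝ) (μ := volume) (r := r) (by simpa using hr)

theorem integrable_vEvenDeriv {u : ℝ} (hu : u ∈ Ioo (-1 : ℝ) 1) (m : ℤ) :
    Integrable (vEvenDeriv u m) :=
  ((integrable_one_add_sq_rpow (r := 2 + u) (by linarith [hu.1])).const_mul _).mono'
    (continuous_vEvenDeriv u m).aestronglyMeasurable
    (Eventually.of_forall (norm_vEvenDeriv_le hu m))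

theorem norm_vEvenDeriv_sq_le {u : ℝ} (hu : u ∈ Ioo (-1 : ℝ) 1) (m : ℤ) (x : ℝ) :
    ‖vEvenDeriv u m x‖ ^ 2 ≤
      (2 * (1 + |(m : ℝ)|)) ^ 2 * (1 + x ^ 2) ^ (-(2 * (2 + u)) / 2) := by
  have h := pow_le_pow_left₀ (norm_nonneg _) (norm_vEvenDeriv_le hu m x) 2
  rw [mul_pow, ← Real.rpow_natCast ((1 + x ^ 2) ^ (-(2 + u) / 2)) 2,
    ← Real.rpow_mul (by positivity)] at h
  have hexp : -(2 * (2 + u)) / 2 = -(2 + u) / 2 * ((2 : ℕ) : ℝ) := by push_cast; ring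
  rwa [hexp]

theorem memLp_vEvenDeriv {u : ℝ} (hu : u ∈ Ioo (-1 : ℝ) 1) (m : ℤ) :
    MemLp (vEvenDeriv u m) 2 := by
  refine (memLp_two_iff_integrable_sq_norm (continuous_vEvenDeriv u m).aestronglyMeasurable).2 ?_
  refine ((integrable_one_add_sq_rpow (r := 2 * (2 + u)) (by linarith [hu.1])).const_mul
    ((2 * (1 + |(m : ℝ)|)) ^ 2)).mono'
    ((continuous_vEvenDeriv u m).norm.pow 2).aestronglyMeasurable (Eventually.of_forall fun x => ?_)
  rw [Real.norm_of_nonneg (by positivity)]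
  exact norm_vEvenDeriv_sq_le hu m x

theorem lintegral_enorm_sq_vEvenDeriv_le {u : ℝ} (hu : u ∈ Ioo (-1 : ℝ) 1) (m : ℤ) :
    ∫⁻ x, ‖vEvenDeriv u m x‖ₑ ^ 2 ≤ ENNReal.ofReal ((2 * (1 + |(m : ℝ)|)) ^ 2 *
      ∫ x : ℝ, (1 + x ^ 2) ^ (-(2 * (2 + u)) / 2)) := by
  rw [← integral_const_mul, ofReal_integral_eq_lintegral_ofReal
    ((integrable_one_add_sq_rpow (by linarith [hu.1])).const_mul _)
    (Eventually.of_forall fun x => by positivity)]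
  refine lintegral_mono fun x => ?_
  rw [← ofReal_norm, ← ENNReal.ofReal_pow (norm_nonneg _)]
  exact ENNReal.ofReal_le_ofReal (norm_vEvenDeriv_sq_le hu m x)

open scoped FourierTransform in
theorem isImpFT_vEven {u : ℝ} (hu : u ∈ Ioo (-1 : ℝ) 1) (m : ℤ) {ξ : ℝ} (hξ : ξ ≠ 0) :
    IsImpFT (vEven u m) ξ (𝓕 (vEvenDeriv u m) ξ / (2 * π * Complex.I * ξ)) := by
  set k : ℂ := 2 * π * Complex.I * ξ with hk
  have hk0 : k ≠ 0 := by
    simp [hk, hξ, Real.pi_ne_zero]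
  set e : ℝ → ℂ := fun x => cexp (-2 * π * Complex.I * x * ξ) with he
  have hexp : ∀ x : ℝ, -2 * (π : ℂ) * Complex.I * x * ξ = ((-2 * π * x * ξ : ℝ) : ℂ) * Complex.I := by
    intro x; push_cast; ring
  have hde : ∀ x, HasDerivAt (fun x => -e x / k) (e x) x := by
    intro x
    have h1 : HasDerivAt (fun x : ℝ => -2 * (π : ℂ) * Complex.I * x * ξ)
        (-2 * (π : ℂ) * Complex.I * 1 * ξ) x :=
      ((Complex.ofRealCLM.hasDerivAt (x := x)).const_mul _).mul_const _
    convert! (h1.cexp.neg.div_const k) using 1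
    simp only [he]
    field_simp
    exact hk
  have hec : Continuous e := by simp only [he]; fun_prop
  have hne : ∀ x, ‖e x‖ = 1 := by
    intro x; simp only [he]; rw [hexp, Complex.norm_exp_ofReal_mul_I]
  have hIBP : ∀ R : ℝ, 0 ≤ R → ∫ x in Ioc (-R) R, vEven u m x * e x =
      vEven u m R * (-e R / k) - vEven u m (-R) * (-e (-R) / k) -
        ∫ x in (-R)..R, vEvenDeriv u m x * (-e x / k) := by
    intro R hR
    rw [← intervalIntegral.integral_of_le (by linarith)]
    exact intervalIntegral.integral_mul_deriv_eq_deriv_mul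
      (fun x _ => hasDerivAt_vEven u m x) (fun x _ => hde x)
      ((continuous_vEvenDeriv u m).intervalIntegrable _ _) (hec.intervalIntegrable _ _)
  have hsq : Tendsto (fun R : ℝ => (1 + R ^ 2)) atTop atTop :=
    tendsto_atTop_add_const_left _ _ (tendsto_pow_atTop two_ne_zero)
  have hpow0 : Tendsto (fun R : ℝ => (1 + R ^ 2) ^ (-(1 + u) / 2)) atTop (nhds 0) := by
    have := (tendsto_rpow_neg_atTop (y := (1 + u) / 2) (by linarith [hu.1])).comp hsq
    refine this.congr fun R => ?_
    simp only [Function.comp]; congr 1; ring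
  have hbd : ∀ s : ℝ → ℝ, (∀ R, s R ^ 2 = R ^ 2) →
      Tendsto (fun R => vEven u m (s R) * (-e (s R) / k)) atTop (nhds 0) := by
    intro s hs
    rw [tendsto_zero_iff_norm_tendsto_zero]
    have : (fun R => ‖vEven u m (s R) * (-e (s R) / k)‖) =
        fun R : ℝ => (1 + R ^ 2) ^ (-(1 + u) / 2) * ‖k‖⁻¹ := by
      funext R
      rw [norm_mul, norm_vEven, hs, norm_div, norm_neg, hne, one_div]
    rw [this]
    simpa using hpow0.mul_const ‖k‖⁻¹
  have hint : Integrable (fun x => vEvenDeriv u m x * (-e x / k)) := by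
    refine ((integrable_vEvenDeriv hu m).norm.mul_const ‖k‖⁻¹).mono'
      ((continuous_vEvenDeriv u m).mul (hec.neg.div_const k)).aestronglyMeasurable
      (Eventually.of_forall fun x => ?_)
    rw [norm_mul, norm_div, norm_neg, hne, one_div]
  have hlim := ((hbd (fun R => R) (fun R => rfl)).sub (hbd (fun R => -R) (fun R => by ring))).sub
    (intervalIntegral_tendsto_integral hint tendsto_neg_atTop_atBot tendsto_id)
  have hval : 𝓕 (vEvenDeriv u m) ξ / k = 0 - 0 - ∫ x, vEvenDeriv u m x * (-e x / k) := by
    rw [Real.fourier_real_eq_integral_exp_smul, sub_zero, zero_sub, ← integral_neg,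
      ← integral_div]
    refine integral_congr_ae (Eventually.of_forall fun x => ?_)
    simp only [he, smul_eq_mul]
    rw [hexp]; ring
  rw [hval]
  refine hlim.congr' ?_
  filter_upwards [eventually_ge_atTop 0] with R hR
  exact (hIBP R hR).symm

/-- First-derivative bound for oscillatory integrals whose amplitude has derivative dominated by
that of `g`. -/
theorem norm_integral_mul_deriv_mul_exp_le {a b : ℝ} (hab : a ≤ b) {f f' g g' φ φ' : ℝ → ℝ}
    (hf : ∀ x ∈ Icc a b, HasDerivAt f (f' x) x) (hf' : ContinuousOn f' (Icc a b))
    (hg : ∀ x ∈ Icc a b, HasDerivAt g (g' x) x) (hg' : ContinuousOn g' (Icc a b))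
    (hφ : ∀ x ∈ Icc a b, HasDerivAt φ (φ' x) x) (hφ' : ContinuousOn φ' (Icc a b))
    (hfg : ∀ x ∈ Icc a b, |f' x| ≤ g' x) :
    ‖∫ x in a..b, ((f x * φ' x : ℝ) : ℂ) * cexp (φ x * Complex.I)‖ ≤
      |f a| + |f b| + (g b - g a) := by
  have hI : uIcc a b = Icc a b := uIcc_of_le hab
  have hne : ∀ x : ℝ, ‖-(Complex.I * cexp (φ x * Complex.I))‖ = 1 := by
    intro x; rw [norm_neg, norm_mul, Complex.norm_I, Complex.norm_exp_ofReal_mul_I, one_mul]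
  have hE : ∀ x ∈ Icc a b, HasDerivAt (fun x => -(Complex.I * cexp (φ x * Complex.I)))
      ((φ' x : ℂ) * cexp (φ x * Complex.I)) x := by
    intro x hx
    convert! (((hφ x hx).ofReal_comp.mul_const Complex.I).cexp.const_mul Complex.I).neg using 1
    linear_combination ((φ' x : ℂ) * cexp (φ x * Complex.I)) * Complex.I_sq
  have hφc : ContinuousOn φ (Icc a b) := fun x hx => (hφ x hx).continuousAt.continuousWithinAt
  have hexpc : ContinuousOn (fun x => cexp (φ x * Complex.I)) (Icc a b) :=
    Complex.continuous_exp.comp_continuousOn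
      ((Complex.continuous_ofReal.comp_continuousOn hφc).mul continuousOn_const)
  have hEc : ContinuousOn (fun x => (φ' x : ℂ) * cexp (φ x * Complex.I)) (Icc a b) :=
    (Complex.continuous_ofReal.comp_continuousOn hφ').mul hexpc
  have hfc : ContinuousOn (fun x => (f' x : ℂ)) (Icc a b) :=
    Complex.continuous_ofReal.comp_continuousOn hf'
  have key := intervalIntegral.integral_mul_deriv_eq_deriv_mul (a := a) (b := b)
    (u := fun x => (f x : ℂ)) (u' := fun x => (f' x : ℂ))
    (v := fun x => -(Complex.I * cexp (φ x * Complex.I)))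
    (v' := fun x => (φ' x : ℂ) * cexp (φ x * Complex.I))
    (by rw [hI]; exact fun x hx => (hf x hx).ofReal_comp) (by rw [hI]; exact hE)
    (by rw [← hI] at hfc; exact hfc.intervalIntegrable)
    (by rw [← hI] at hEc; exact hEc.intervalIntegrable)
  have hint : IntervalIntegrable g' volume a b := by
    rw [← hI] at hg'; exact hg'.intervalIntegrable
  have hrem : ‖∫ x in a..b, (f' x : ℂ) * -(Complex.I * cexp (φ x * Complex.I))‖ ≤ g b - g a := by
    rw [← intervalIntegral.integral_eq_sub_of_hasDerivAt (by rw [hI]; exact hg) hint]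
    refine intervalIntegral.norm_integral_le_of_norm_le hab
      (Eventually.of_forall fun x hx => ?_) hint
    rw [norm_mul, hne, mul_one, Complex.norm_real, Real.norm_eq_abs]
    exact hfg x ⟨hx.1.le, hx.2⟩
  have hlhs : ∫ x in a..b, ((f x * φ' x : ℝ) : ℂ) * cexp (φ x * Complex.I) =
      ∫ x in a..b, (f x : ℂ) * ((φ' x : ℂ) * cexp (φ x * Complex.I)) := by
    congr 1; funext x; push_cast; ring
  rw [hlhs, key]
  refine (norm_sub_le _ _).trans (add_le_add ((norm_sub_le _ _).trans ?_) hrem)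
  rw [norm_mul, norm_mul, hne, hne, mul_one, mul_one, Complex.norm_real, Complex.norm_real,
    Real.norm_eq_abs, Real.norm_eq_abs, add_comm]

/-- The integrand `(1+x²)^{γ-1} e^{i(p arctan x - b x)}`. -/
def oscIntegrand (γ p b x : ℝ) : ℂ :=
  (((1 + x ^ 2) ^ (γ - 1) : ℝ) : ℂ) * cexp ((p * Real.arctan x - b * x : ℝ) * Complex.I)

theorem continuous_one_add_sq_rpow (r : ℝ) : Continuous (fun x : ℝ => (1 + x ^ 2) ^ r) :=
  continuous_iff_continuousAt.2 fun x => (hasDerivAt_one_add_sq_rpow r x).continuousAt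

theorem continuous_oscIntegrand (γ p b : ℝ) : Continuous (oscIntegrand γ p b) := by
  refine (Complex.continuous_ofReal.comp (continuous_one_add_sq_rpow _)).mul ?_
  fun_prop

theorem norm_oscIntegrand (γ p b x : ℝ) : ‖oscIntegrand γ p b x‖ = (1 + x ^ 2) ^ (γ - 1) := by
  rw [oscIntegrand, norm_mul, Complex.norm_exp_ofReal_mul_I, mul_one, Complex.norm_real,
    Real.norm_of_nonneg (by positivity)]

/-- Amplitude divided by the derivative of the phase of `oscIntegrand`. -/
def ampQuot (γ p b x : ℝ) : ℝ := (1 + x ^ 2) ^ γ / (p - b * (1 + x ^ 2))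

/-- The derivative of `ampQuot`. -/
def ampQuotDeriv (γ p b x : ℝ) : ℝ :=
  2 * x * (1 + x ^ 2) ^ (γ - 1) * (γ * (p - b * (1 + x ^ 2)) + b * (1 + x ^ 2)) /
    (p - b * (1 + x ^ 2)) ^ 2

theorem hasDerivAt_ampQuot {γ p b x : ℝ} (h : p - b * (1 + x ^ 2) ≠ 0) :
    HasDerivAt (ampQuot γ p b) (ampQuotDeriv γ p b x) x := by
  have h1 : HasDerivAt (fun x : ℝ => p - b * (1 + x ^ 2)) (-(b * (2 * x))) x := by
    simpa using (((hasDerivAt_pow 2 x).const_add 1).const_mul b).const_sub p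
  convert! (hasDerivAt_one_add_sq_rpow γ x).div h1 h using 1
  have hy : (0 : ℝ) < 1 + x ^ 2 := by positivity
  rw [ampQuotDeriv, Real.rpow_sub_one hy.ne']
  field_simp
  ring

theorem norm_integral_oscIntegrand_le {γ p b s t : ℝ} (hst : s ≤ t) {g g' : ℝ → ℝ}
    (h : ∀ x ∈ Icc s t, p - b * (1 + x ^ 2) ≠ 0)
    (hg : ∀ x ∈ Icc s t, HasDerivAt g (g' x) x) (hg' : ContinuousOn g' (Icc s t))
    (hfg : ∀ x ∈ Icc s t, |ampQuotDeriv γ p b x| ≤ g' x) :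
    ‖∫ x in s..t, oscIntegrand γ p b x‖ ≤
      |ampQuot γ p b s| + |ampQuot γ p b t| + (g t - g s) := by
  have hφ : ∀ x : ℝ, HasDerivAt (fun x => p * Real.arctan x - b * x) (p / (1 + x ^ 2) - b) x := by
    intro x
    convert! ((Real.hasDerivAt_arctan x).const_mul p).sub ((hasDerivAt_id x).const_mul b) using 1
    ring
  have hφ' : Continuous (fun x : ℝ => p / (1 + x ^ 2) - b) :=
    (continuous_const.div (by fun_prop) (fun x => by positivity)).sub continuous_const
  have hf' : ContinuousOn (ampQuotDeriv γ p b) (Icc s t) := by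
    refine ContinuousOn.div (Continuous.continuousOn ?_) (Continuous.continuousOn (by fun_prop))
      (fun x hx => pow_ne_zero 2 (h x hx))
    have := continuous_one_add_sq_rpow (γ - 1)
    fun_prop
  have key := norm_integral_mul_deriv_mul_exp_le hst
    (fun x hx => hasDerivAt_ampQuot (γ := γ) (h x hx)) hf' hg hg'
    (fun x _ => hφ x) hφ'.continuousOn hfg
  refine le_of_eq_of_le (congrArg _ ?_) key
  refine intervalIntegral.integral_congr fun x hx => ?_
  rw [uIcc_of_le hst] at hx
  have hx' := h x hx
  have hy : (0 : ℝ) < 1 + x ^ 2 := by positivity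
  have : ampQuot γ p b x * (p / (1 + x ^ 2) - b) = (1 + x ^ 2) ^ (γ - 1) := by
    rw [ampQuot, Real.rpow_sub_one hy.ne']
    rw [mul_comm b] at hx' ⊢
    field_simp
  simp only [oscIntegrand, this]

theorem hasDerivAt_one_add_sq_rpow_div {r : ℝ} (hr : r ≠ 0) (c x : ℝ) :
    HasDerivAt (fun x : ℝ => (1 + x ^ 2) ^ r / (r * c)) (2 * x * (1 + x ^ 2) ^ (r - 1) / c) x := by
  convert! (hasDerivAt_one_add_sq_rpow r x).div_const (r * c) using 1
  by_cases hc : c = 0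
  · simp [hc]
  · field_simp

theorem abs_ampQuotDeriv_le {γ p β x : ℝ} (hγ : γ ∈ Ioo (0 : ℝ) 1) (hp : 0 ≤ p) (hβ : 0 < β)
    (hx : 0 ≤ x) :
    |ampQuotDeriv γ p (-β) x| ≤ 2 * x * (1 + x ^ 2) ^ (γ - 1) / (p + β * (1 + x ^ 2)) := by
  have hD : 0 < p + β * (1 + x ^ 2) := by positivity
  have hDe : p - -β * (1 + x ^ 2) = p + β * (1 + x ^ 2) := by ring
  rw [ampQuotDeriv, hDe, abs_div, abs_mul, abs_of_nonneg (a := 2 * x * _) (by positivity),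
    abs_of_pos (a := _ ^ 2) (by positivity), div_le_div_iff₀ (by positivity) hD]
  have h1 : |γ * (p + β * (1 + x ^ 2)) + -β * (1 + x ^ 2)| ≤ p + β * (1 + x ^ 2) := by
    have : 0 < β * (1 + x ^ 2) := by positivity
    rw [abs_le]
    constructor
    · nlinarith [mul_pos hγ.1 hD]
    · nlinarith [mul_pos (sub_pos.2 hγ.2) hD]
  have h2 : 0 ≤ 2 * x * (1 + x ^ 2) ^ (γ - 1) := by positivity
  calc _ ≤ 2 * x * (1 + x ^ 2) ^ (γ - 1) * (p + β * (1 + x ^ 2)) * (p + β * (1 + x ^ 2)) := by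
        gcongr
    _ = _ := by ring

theorem abs_ampQuot_neg {γ p β x : ℝ} (hp : 0 ≤ p) (hβ : 0 < β) :
    |ampQuot γ p (-β) x| = (1 + x ^ 2) ^ γ / (p + β * (1 + x ^ 2)) := by
  have hDe : p - -β * (1 + x ^ 2) = p + β * (1 + x ^ 2) := by ring
  rw [ampQuot, hDe, abs_of_nonneg (by positivity)]

theorem norm_integral_tail_le {γ p β X R : ℝ} (hγ : γ ∈ Ioo (0 : ℝ) 1) (hp : 0 ≤ p) (hβ : 0 < β)
    (hX : 0 ≤ X) (hXR : X ≤ R) :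
    ‖∫ x in X..R, oscIntegrand γ p (-β) x‖ ≤
      (2 + 1 / (1 - γ)) * ((1 + X ^ 2) ^ (γ - 1) / β) := by
  have hγ' : γ - 1 ≠ 0 := by linarith [hγ.2]
  have h1γ : 0 < 1 - γ := by linarith [hγ.2]
  have key := norm_integral_oscIntegrand_le (γ := γ) (p := p) (b := -β) hXR
    (g := fun x => (1 + x ^ 2) ^ (γ - 1) / ((γ - 1) * β))
    (g' := fun x => 2 * x * (1 + x ^ 2) ^ (γ - 1 - 1) / β)
    (fun x hx => by
      have : 0 < p + β * (1 + x ^ 2) := by positivity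
      intro h; linarith)
    (fun x _ => hasDerivAt_one_add_sq_rpow_div hγ' β x)
    (by
      have := continuous_one_add_sq_rpow (γ - 1 - 1)
      exact Continuous.continuousOn (by fun_prop))
    (fun x hx => by
      have hx0 : 0 ≤ x := hX.trans hx.1
      refine (abs_ampQuotDeriv_le hγ hp hβ hx0).trans ?_
      have hy : (0 : ℝ) < 1 + x ^ 2 := by positivity
      rw [Real.rpow_sub_one hy.ne' (γ - 1), mul_div_assoc', div_div, mul_comm (1 + x ^ 2) β]
      gcongr
      linarith)
  have hf : ∀ x, X ≤ x → |ampQuot γ p (-β) x| ≤ (1 + X ^ 2) ^ (γ - 1) / β := by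
    intro x hx
    have hy : (0 : ℝ) < 1 + x ^ 2 := by positivity
    calc |ampQuot γ p (-β) x| = (1 + x ^ 2) ^ γ / (p + β * (1 + x ^ 2)) := abs_ampQuot_neg hp hβ
      _ ≤ (1 + x ^ 2) ^ γ / (β * (1 + x ^ 2)) :=
        div_le_div_of_nonneg_left (by positivity) (by positivity) (by linarith)
      _ = (1 + x ^ 2) ^ (γ - 1) / β := by rw [Real.rpow_sub_one hy.ne']; field_simp
      _ ≤ _ := div_le_div_of_nonneg_right
        (Real.rpow_le_rpow_of_nonpos (by positivity) (by gcongr) (by linarith)) hβ.le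
  have hg : (1 + R ^ 2) ^ (γ - 1) / ((γ - 1) * β) - (1 + X ^ 2) ^ (γ - 1) / ((γ - 1) * β) ≤
      1 / (1 - γ) * ((1 + X ^ 2) ^ (γ - 1) / β) := by
    have h1 : ∀ z : ℝ, z / ((γ - 1) * β) = -(1 / (1 - γ) * (z / β)) := by
      intro z
      have : γ - 1 = -(1 - γ) := by ring
      rw [this]; field_simp
    rw [h1, h1]
    have : 0 ≤ 1 / (1 - γ) * ((1 + R ^ 2) ^ (γ - 1) / β) := by positivity
    linarith
  linarith [hf X le_rfl, hf R hXR]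

theorem norm_integral_head_le {γ p β X : ℝ} (hγ : γ ∈ Ioo (0 : ℝ) 1) (hp : 0 < p) (hβ : 0 < β)
    (hX : 0 ≤ X) :
    ‖∫ x in 0..X, oscIntegrand γ p (-β) x‖ ≤ (2 + 1 / γ) * ((1 + X ^ 2) ^ γ / p) := by
  have hγ0 := hγ.1
  have key := norm_integral_oscIntegrand_le (γ := γ) (p := p) (b := -β) hX
    (g := fun x => (1 + x ^ 2) ^ γ / (γ * p))
    (g' := fun x => 2 * x * (1 + x ^ 2) ^ (γ - 1) / p)
    (fun x hx => by
      have : 0 < p + β * (1 + x ^ 2) := by positivity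
      intro h; linarith)
    (fun x _ => hasDerivAt_one_add_sq_rpow_div hγ.1.ne' p x)
    (by
      have := continuous_one_add_sq_rpow (γ - 1)
      exact Continuous.continuousOn (by fun_prop))
    (fun x hx => by
      have hx0 : 0 ≤ x := hx.1
      refine (abs_ampQuotDeriv_le hγ hp.le hβ hx0).trans ?_
      have hy : 0 < β * (1 + x ^ 2) := by positivity
      gcongr
      linarith)
  have hf : ∀ x, 0 ≤ x → x ≤ X → |ampQuot γ p (-β) x| ≤ (1 + X ^ 2) ^ γ / p := by
    intro x hx0 hx
    have hy : 0 < β * (1 + x ^ 2) := by positivity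
    rw [abs_ampQuot_neg hp.le hβ]
    gcongr
    linarith
  have hg : (1 + X ^ 2) ^ γ / (γ * p) - (1 + (0 : ℝ) ^ 2) ^ γ / (γ * p) ≤
      1 / γ * ((1 + X ^ 2) ^ γ / p) := by
    have h1 : (1 + X ^ 2) ^ γ / (γ * p) = 1 / γ * ((1 + X ^ 2) ^ γ / p) := by field_simp
    have : 0 ≤ (1 + (0 : ℝ) ^ 2) ^ γ / (γ * p) := by positivity
    linarith
  linarith [hf X hX le_rfl, hf 0 le_rfl hX]

theorem norm_integral_head_trivial_le {γ p b X : ℝ} (hγ : γ ∈ Ioo (0 : ℝ) 1) (hX : 0 ≤ X) :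
    ‖∫ x in 0..X, oscIntegrand γ p b x‖ ≤ (1 / γ + π) * (1 + X ^ 2) ^ γ := by
  have hγ0 := hγ.1
  have hg : ∀ x : ℝ, HasDerivAt (fun x => (1 + x ^ 2) ^ γ / (γ * 1) + 2 * Real.arctan x)
      (2 * x * (1 + x ^ 2) ^ (γ - 1) / 1 + 2 * (1 / (1 + x ^ 2))) x := fun x =>
    (hasDerivAt_one_add_sq_rpow_div hγ.1.ne' 1 x).add ((Real.hasDerivAt_arctan x).const_mul 2)
  have hc : Continuous fun x : ℝ => 2 * x * (1 + x ^ 2) ^ (γ - 1) / 1 + 2 * (1 / (1 + x ^ 2)) := by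
    have := continuous_one_add_sq_rpow (γ - 1)
    have h2 : Continuous fun x : ℝ => 1 / (1 + x ^ 2) :=
      continuous_const.div (by fun_prop) (fun x => by positivity)
    fun_prop
  have hle : ‖∫ x in 0..X, oscIntegrand γ p b x‖ ≤
      ∫ x in 0..X, (2 * x * (1 + x ^ 2) ^ (γ - 1) / 1 + 2 * (1 / (1 + x ^ 2))) := by
    refine intervalIntegral.norm_integral_le_of_norm_le hX
      (Eventually.of_forall fun x hx => ?_) (hc.intervalIntegrable _ _)
    rw [norm_oscIntegrand]
    have hx0 : 0 < x := hx.1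
    have hpos : 0 ≤ (1 + x ^ 2) ^ (γ - 1) := by positivity
    rcases le_total (1 / 2) x with h | h
    · have : 0 ≤ 2 * (1 / (1 + x ^ 2)) := by positivity
      nlinarith
    · have h1 : (1 + x ^ 2) ^ (γ - 1) ≤ 1 :=
        Real.rpow_le_one_of_one_le_of_nonpos (by nlinarith) (by linarith [hγ.2])
      have h2 : 1 ≤ 2 * (1 / (1 + x ^ 2)) := by
        rw [mul_one_div, le_div_iff₀ (by positivity)]; nlinarith
      have : 0 ≤ 2 * x * (1 + x ^ 2) ^ (γ - 1) / 1 := by positivity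
      linarith
  rw [intervalIntegral.integral_eq_sub_of_hasDerivAt (fun x _ => hg x)
    (hc.intervalIntegrable _ _)] at hle
  have h1 : (1 : ℝ) ≤ (1 + X ^ 2) ^ γ := Real.one_le_rpow (by nlinarith) hγ.1.le
  have h2 : (1 + X ^ 2) ^ γ / (γ * 1) = 1 / γ * (1 + X ^ 2) ^ γ := by field_simp
  have h3 : 0 ≤ (1 + (0 : ℝ) ^ 2) ^ γ / (γ * 1) := by positivity
  have h4 := Real.arctan_lt_pi_div_two X
  rw [Real.arctan_zero] at hle
  nlinarith [Real.pi_pos]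

theorem norm_integral_oscIntegrand_neg_le {γ p β R : ℝ} (hγ : γ ∈ Ioo (0 : ℝ) 1) (hp : 0 < p)
    (hβ : 0 < β) (hβp : β ≤ p) (hR : √(p / β - 1) ≤ R) :
    ‖∫ x in 0..R, oscIntegrand γ p (-β) x‖ ≤
      (4 + 1 / γ + 1 / (1 - γ)) * (p ^ (γ - 1) * β ^ (-γ)) := by
  have hX := Real.sqrt_nonneg (p / β - 1)
  have h1 : 1 ≤ p / β := (one_le_div hβ).2 hβp
  have hY : 1 + √(p / β - 1) ^ 2 = p / β := by rw [Real.sq_sqrt (by linarith)]; ring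
  have hc := continuous_oscIntegrand γ p (-β)
  rw [← intervalIntegral.integral_add_adjacent_intervals (hc.intervalIntegrable 0 √(p / β - 1))
    (hc.intervalIntegrable _ R)]
  have e1 : (p / β) ^ γ / p = p ^ (γ - 1) * β ^ (-γ) := by
    rw [Real.div_rpow hp.le hβ.le, Real.rpow_sub_one hp.ne', Real.rpow_neg hβ.le]
    field_simp
  have e2 : (p / β) ^ (γ - 1) / β = p ^ (γ - 1) * β ^ (-γ) := by
    rw [Real.div_rpow hp.le hβ.le, Real.rpow_sub_one hβ.ne', Real.rpow_neg hβ.le]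
    field_simp
  have a1 := norm_integral_head_le hγ hp hβ hX
  have a2 := norm_integral_tail_le hγ hp.le hβ hX hR
  rw [hY] at a1 a2
  rw [e1] at a1
  rw [e2] at a2
  refine (norm_add_le _ _).trans ((add_le_add a1 a2).trans (le_of_eq ?_))
  ring

theorem norm_integral_oscIntegrand_zero_le {γ β R : ℝ} (hγ : γ ∈ Ioo (0 : ℝ) 1)
    (hβ : 0 < β) (hβ1 : β ≤ 1) (hR : √(1 / β - 1) ≤ R) :
    ‖∫ x in 0..R, oscIntegrand γ 0 (-β) x‖ ≤
      (1 / γ + π + (2 + 1 / (1 - γ))) * β ^ (-γ) := by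
  have hX := Real.sqrt_nonneg (1 / β - 1)
  have h1 : 1 ≤ 1 / β := (one_le_div hβ).2 hβ1
  have hY : 1 + √(1 / β - 1) ^ 2 = β⁻¹ := by rw [Real.sq_sqrt (by linarith)]; ring
  have hc := continuous_oscIntegrand γ 0 (-β)
  rw [← intervalIntegral.integral_add_adjacent_intervals (hc.intervalIntegrable 0 √(1 / β - 1))
    (hc.intervalIntegrable _ R)]
  have e1 : β⁻¹ ^ γ = β ^ (-γ) := by
    rw [Real.inv_rpow hβ.le, Real.rpow_neg hβ.le]
  have e2 : β⁻¹ ^ (γ - 1) / β = β ^ (-γ) := by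
    rw [Real.inv_rpow hβ.le, Real.rpow_sub_one hβ.ne', Real.rpow_neg hβ.le]
    field_simp
  have a1 := norm_integral_head_trivial_le (p := 0) (b := -β) hγ hX
  have a2 := norm_integral_tail_le hγ le_rfl hβ hX hR
  rw [hY] at a1 a2
  rw [e1] at a1
  rw [e2] at a2
  refine (norm_add_le _ _).trans ((add_le_add a1 a2).trans (le_of_eq ?_))
  ring

theorem ampQuotDeriv_nonneg {γ p b x : ℝ} (hγ : γ ∈ Ioo (0 : ℝ) 1) (hp : 0 ≤ p) (hb : 0 ≤ b)
    (hx : 0 ≤ x) : 0 ≤ ampQuotDeriv γ p b x := by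
  have h1 := hγ.1.le
  have h2 : 0 ≤ 1 - γ := by linarith [hγ.2]
  have : 0 ≤ γ * (p - b * (1 + x ^ 2)) + b * (1 + x ^ 2) := by
    have e : γ * (p - b * (1 + x ^ 2)) + b * (1 + x ^ 2) =
      γ * p + (1 - γ) * (b * (1 + x ^ 2)) := by ring
    rw [e]; positivity
  rw [ampQuotDeriv]
  positivity

theorem norm_integral_oscIntegrand_le_of_monotone {γ p b s t : ℝ} (hγ : γ ∈ Ioo (0 : ℝ) 1)
    (hp : 0 ≤ p) (hb : 0 ≤ b) (hs : 0 ≤ s) (hst : s ≤ t)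
    (h : ∀ x ∈ Icc s t, p - b * (1 + x ^ 2) ≠ 0) :
    ‖∫ x in s..t, oscIntegrand γ p b x‖ ≤
      |ampQuot γ p b s| + |ampQuot γ p b t| + (ampQuot γ p b t - ampQuot γ p b s) := by
  have hf' : ContinuousOn (ampQuotDeriv γ p b) (Icc s t) := by
    refine ContinuousOn.div (Continuous.continuousOn ?_) (Continuous.continuousOn (by fun_prop))
      (fun x hx => pow_ne_zero 2 (h x hx))
    have := continuous_one_add_sq_rpow (γ - 1)
    fun_prop
  exact norm_integral_oscIntegrand_le hst h (fun x hx => hasDerivAt_ampQuot (h x hx)) hf'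
    (fun x hx => (abs_of_nonneg (ampQuotDeriv_nonneg hγ hp hb (hs.trans hx.1))).le)

/-- Splitting at the stationary point `x₀ = √(p/b - 1)` with a window of relative width `l`. -/
theorem norm_integral_oscIntegrand_window_le {γ p b x₀ l R : ℝ} (hγ : γ ∈ Ioo (0 : ℝ) 1)
    (hb : 0 < b) (hx₀ : 1 ≤ x₀) (hp : p = b * (1 + x₀ ^ 2)) (hl : 0 < l) (hl2 : l ≤ 1 / 2)
    (hR : 2 * x₀ ≤ R) :
    ‖∫ x in 0..R, oscIntegrand γ p b x‖ ≤
      12 * ((x₀ ^ 2) ^ (γ - 1) / (b * l)) + 8 * (l * x₀ * (x₀ ^ 2) ^ (γ - 1)) := by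
  have hx0 : 0 < x₀ := by linarith
  have hp0 : 0 ≤ p := by rw [hp]; positivity
  have hγ1 : γ - 1 ≤ 0 := by linarith [hγ.2]
  set s := x₀ * (1 - l) with hs
  set t := x₀ * (1 + l) with ht
  have hlx : l * x₀ ≤ x₀ / 2 := by nlinarith
  have hs0 : x₀ / 2 ≤ s := by rw [hs]; linarith
  have hst : s ≤ t := by rw [hs, ht]; nlinarith
  have htR : t ≤ R := by rw [ht]; linarith
  have hden : ∀ x, p - b * (1 + x ^ 2) = b * (x₀ ^ 2 - x ^ 2) := by intro x; rw [hp]; ring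
  have hQ : (0 : ℝ) < x₀ ^ 2 := by positivity
  have hQ1 : (1 : ℝ) ≤ x₀ ^ 2 := by nlinarith
  have hlQ : 0 < l * x₀ ^ 2 := by positivity
  have hsQ : l * x₀ ^ 2 ≤ x₀ ^ 2 - s ^ 2 := by
    have : x₀ ^ 2 - s ^ 2 - l * x₀ ^ 2 = l * x₀ ^ 2 * (1 - l) := by rw [hs]; ring
    nlinarith
  have htQ : l * x₀ ^ 2 ≤ t ^ 2 - x₀ ^ 2 := by
    have : t ^ 2 - x₀ ^ 2 - l * x₀ ^ 2 = l * x₀ ^ 2 * (1 + l) := by rw [ht]; ring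
    nlinarith
  have hpow : ∀ c y : ℝ, 1 ≤ c → 0 ≤ y → y ≤ c * x₀ ^ 2 → y ^ γ ≤ c * (x₀ ^ 2) ^ γ := by
    intro c y hc hy0 hy
    calc y ^ γ ≤ (c * x₀ ^ 2) ^ γ := Real.rpow_le_rpow hy0 hy hγ.1.le
      _ = c ^ γ * (x₀ ^ 2) ^ γ := Real.mul_rpow (by linarith) hQ.le
      _ ≤ c * (x₀ ^ 2) ^ γ := by
        gcongr
        simpa using Real.rpow_le_rpow_of_exponent_le hc hγ.2.le
  have hQγ : (x₀ ^ 2) ^ γ / (b * (l * x₀ ^ 2)) = (x₀ ^ 2) ^ (γ - 1) / (b * l) := by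
    rw [Real.rpow_sub_one hQ.ne']; field_simp
  have hleft : ‖∫ x in 0..s, oscIntegrand γ p b x‖ ≤ 4 * ((x₀ ^ 2) ^ (γ - 1) / (b * l)) := by
    have hpos : ∀ x ∈ Icc 0 s, l * x₀ ^ 2 ≤ x₀ ^ 2 - x ^ 2 := by
      intro x hx
      have : x ^ 2 ≤ s ^ 2 := pow_le_pow_left₀ hx.1 hx.2 2
      linarith
    have key := norm_integral_oscIntegrand_le_of_monotone hγ hp0 hb.le le_rfl (by linarith : 0 ≤ s)
      (fun x hx => by
        rw [hden]; exact mul_ne_zero hb.ne' (by linarith [hpos x hx]))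
    have hnn : ∀ x ∈ Icc 0 s, 0 ≤ ampQuot γ p b x := by
      intro x hx
      rw [ampQuot, hden]
      have := hpos x hx
      have h' : 0 ≤ x₀ ^ 2 - x ^ 2 := by linarith
      positivity
    rw [abs_of_nonneg (hnn 0 ⟨le_rfl, by linarith⟩), abs_of_nonneg (hnn s ⟨by linarith, le_rfl⟩)]
      at key
    have hb2 : ampQuot γ p b s ≤ 2 * (x₀ ^ 2) ^ γ / (b * (l * x₀ ^ 2)) := by
      rw [ampQuot, hden]
      gcongr
      exact hpow 2 _ one_le_two (by positivity) (by linarith)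
    rw [mul_div_assoc, hQγ] at hb2
    linarith
  have hright : ‖∫ x in t..R, oscIntegrand γ p b x‖ ≤ 8 * ((x₀ ^ 2) ^ (γ - 1) / (b * l)) := by
    have ht0 : 0 ≤ t := by linarith
    have hpos : ∀ x ∈ Icc t R, l * x₀ ^ 2 ≤ x ^ 2 - x₀ ^ 2 := by
      intro x hx
      have : t ^ 2 ≤ x ^ 2 := pow_le_pow_left₀ ht0 hx.1 2
      linarith
    have key := norm_integral_oscIntegrand_le_of_monotone hγ hp0 hb.le ht0 htR
      (fun x hx => by
        rw [hden]; exact mul_ne_zero hb.ne' (by linarith [hpos x hx]))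
    have hneg : ∀ x, ampQuot γ p b x = -((1 + x ^ 2) ^ γ / (b * (x ^ 2 - x₀ ^ 2))) := by
      intro x
      rw [ampQuot, hden, ← div_neg]; congr 1; ring
    have hnn : ∀ x ∈ Icc t R, ampQuot γ p b x ≤ 0 := by
      intro x hx
      have := hpos x hx
      have h' : 0 ≤ x ^ 2 - x₀ ^ 2 := by linarith
      rw [hneg]
      have : 0 ≤ (1 + x ^ 2) ^ γ / (b * (x ^ 2 - x₀ ^ 2)) := by positivity
      linarith
    rw [abs_of_nonpos (hnn t ⟨le_rfl, htR⟩), abs_of_nonpos (hnn R ⟨htR, le_rfl⟩)] at key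
    have hb2 : -ampQuot γ p b t ≤ 4 * (x₀ ^ 2) ^ γ / (b * (l * x₀ ^ 2)) := by
      rw [hneg, neg_neg]
      gcongr
      refine hpow 4 _ (by norm_num) (by positivity) ?_
      have : t ≤ 3 / 2 * x₀ := by rw [ht]; linarith
      nlinarith
    rw [mul_div_assoc, hQγ] at hb2
    linarith
  have hmid : ‖∫ x in s..t, oscIntegrand γ p b x‖ ≤ 8 * (l * x₀ * (x₀ ^ 2) ^ (γ - 1)) := by
    have hle : ∀ x ∈ uIoc s t, ‖oscIntegrand γ p b x‖ ≤ 4 * (x₀ ^ 2) ^ (γ - 1) := by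
      intro x hx
      rw [uIoc_of_le hst] at hx
      rw [norm_oscIntegrand]
      calc (1 + x ^ 2) ^ (γ - 1) ≤ (1 / 4 * x₀ ^ 2) ^ (γ - 1) :=
            Real.rpow_le_rpow_of_nonpos (by positivity) (by nlinarith [hx.1]) hγ1
        _ = (1 / 4) ^ (γ - 1) * (x₀ ^ 2) ^ (γ - 1) := Real.mul_rpow (by norm_num) hQ.le
        _ ≤ 4 * (x₀ ^ 2) ^ (γ - 1) := by
          gcongr
          have := Real.rpow_le_rpow_of_exponent_ge (x := 1 / 4) (by norm_num) (by norm_num)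
            (by linarith [hγ.1] : (-1 : ℝ) ≤ γ - 1)
          rw [Real.rpow_neg_one] at this
          norm_num at this ⊢
          exact this
    refine (intervalIntegral.norm_integral_le_of_norm_le_const hle).trans (le_of_eq ?_)
    rw [abs_of_nonneg (by linarith), hs, ht]; ring
  have hc := continuous_oscIntegrand γ p b
  rw [← intervalIntegral.integral_add_adjacent_intervals (hc.intervalIntegrable 0 t)
    (hc.intervalIntegrable t R),
    ← intervalIntegral.integral_add_adjacent_intervals (hc.intervalIntegrable 0 s)
    (hc.intervalIntegrable s t)]
  refine (norm_add₃_le ..).trans ?_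
  linarith

theorem norm_integral_oscIntegrand_pos_le {γ p b R : ℝ} (hγ : γ ∈ Ioo (0 : ℝ) 1) (hp : 2 ≤ p)
    (hb : 0 < b) (hbp : b ≤ p / 2) (hR : 2 * √(p / b - 1) ≤ R) :
    ‖∫ x in 0..R, oscIntegrand γ p b x‖ ≤ 112 * (p ^ (γ - 1) * √p * b ^ (-γ)) := by
  have hp0 : 0 < p := by linarith
  have h2 : 2 ≤ p / b := by rw [le_div_iff₀ hb]; linarith
  set x₀ := √(p / b - 1) with hx₀
  have hQ : x₀ ^ 2 = p / b - 1 := Real.sq_sqrt (by linarith)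
  have hx1 : 1 ≤ x₀ := Real.one_le_sqrt.2 (by linarith)
  have hbb : √b * √b = b := Real.mul_self_sqrt hb.le
  have hs1 : 1 ≤ √(1 + b) := Real.one_le_sqrt.2 (by linarith)
  have key := norm_integral_oscIntegrand_window_le (γ := γ) (p := p) (l := 1 / (2 * √(1 + b))) hγ hb
    hx1 (by rw [hQ]; field_simp; ring) (by positivity)
    (by rw [div_le_div_iff₀ (by positivity) (by norm_num)]; linarith) hR
  have hpb : p / b / 2 ≤ x₀ ^ 2 := by rw [hQ]; linarith
  have hxp : √b * x₀ ≤ √p := by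
    rw [hx₀, ← Real.sqrt_mul hb.le]
    refine Real.sqrt_le_sqrt ?_
    rw [mul_sub, mul_div_cancel₀ _ hb.ne']; linarith
  have hA : (x₀ ^ 2) ^ (γ - 1) ≤ 2 * (p ^ (γ - 1) * b ^ (1 - γ)) := by
    calc (x₀ ^ 2) ^ (γ - 1) ≤ (1 / 2 * (p / b)) ^ (γ - 1) :=
          Real.rpow_le_rpow_of_nonpos (by positivity) (by linarith) (by linarith [hγ.2])
      _ = (1 / 2) ^ (γ - 1) * (p ^ (γ - 1) / b ^ (γ - 1)) := by
        rw [Real.mul_rpow (by norm_num) (by positivity), Real.div_rpow hp0.le hb.le]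
      _ ≤ 2 * (p ^ (γ - 1) * b ^ (1 - γ)) := by
        have e : b ^ (1 - γ) = (b ^ (γ - 1))⁻¹ := by rw [← Real.rpow_neg hb.le]; congr 1; ring
        rw [e, ← div_eq_mul_inv]
        gcongr
        have := Real.rpow_le_rpow_of_exponent_ge (x := 1 / 2) (by norm_num) (by norm_num)
          (by linarith [hγ.1] : (-1 : ℝ) ≤ γ - 1)
        rw [Real.rpow_neg_one] at this
        norm_num at this ⊢
        exact this
  have hb1 : b ^ (1 - γ) = b * b ^ (-γ) := by
    rw [sub_eq_add_neg, Real.rpow_add hb, Real.rpow_one]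
  have hsum : 12 * (1 / (b * (1 / (2 * √(1 + b))))) + 8 * (1 / (2 * √(1 + b)) * x₀) ≤
      56 * (√p / b) := by
    have e1 : 1 / (b * (1 / (2 * √(1 + b)))) ≤ 4 * (√p / b) := by
      have : 1 / (b * (1 / (2 * √(1 + b)))) = 2 * √(1 + b) / b := by field_simp
      rw [this, mul_div_assoc']
      gcongr <;> linarith
    have e2 : 1 / (2 * √(1 + b)) * x₀ ≤ √p / b := by
      rw [one_div_mul_eq_div, div_le_div_iff₀ (by positivity) hb]
      have : √b ≤ √(1 + b) := Real.sqrt_le_sqrt (by linarith)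
      calc x₀ * b = (√b * x₀) * √b := by rw [mul_right_comm, hbb, mul_comm]
        _ ≤ √p * (2 * √(1 + b)) := by gcongr; linarith
    linarith
  calc _ ≤ _ := key
    _ = (x₀ ^ 2) ^ (γ - 1) *
        (12 * (1 / (b * (1 / (2 * √(1 + b))))) + 8 * (1 / (2 * √(1 + b)) * x₀)) := by ring
    _ ≤ 2 * (p ^ (γ - 1) * b ^ (1 - γ)) * (56 * (√p / b)) := by gcongr
    _ = _ := by rw [hb1]; field_simp; norm_num

theorem oscIntegrand_neg_neg (γ p b x : ℝ) :
    oscIntegrand γ (-p) (-b) x = starRingEnd ℂ (oscIntegrand γ p b x) := by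
  rw [oscIntegrand, oscIntegrand, map_mul, ← Complex.exp_conj, map_mul, Complex.conj_ofReal,
    Complex.conj_ofReal, Complex.conj_I]
  congr 2
  push_cast
  ring

theorem oscIntegrand_neg_right (γ p b x : ℝ) :
    oscIntegrand γ p b (-x) = starRingEnd ℂ (oscIntegrand γ p b x) := by
  rw [← oscIntegrand_neg_neg, oscIntegrand, oscIntegrand, neg_sq, Real.arctan_neg]
  congr 4
  ring

theorem norm_integral_oscIntegrand_neg_neg (γ p b s t : ℝ) :
    ‖∫ x in s..t, oscIntegrand γ (-p) (-b) x‖ = ‖∫ x in s..t, oscIntegrand γ p b x‖ := by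
  simp_rw [oscIntegrand_neg_neg]
  rw [intervalIntegral.intervalIntegral_eq_integral_uIoc,
    intervalIntegral.intervalIntegral_eq_integral_uIoc, integral_conj, norm_smul, norm_smul,
    RCLike.norm_conj]

/-- The constant in the low-frequency bound. -/
def lowFreqConst (γ : ℝ) : ℝ := 232 + 2 * π + 2 / γ + 2 / (1 - γ)

theorem lowFreqConst_pos {γ : ℝ} (hγ : γ ∈ Ioo (0 : ℝ) 1) : 0 < lowFreqConst γ := by
  have h1 := hγ.1
  have h2 : 0 < 1 - γ := by linarith [hγ.2]
  rw [lowFreqConst]; positivity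

theorem eventually_norm_integral_oscIntegrand_le_of_two_le {γ p b : ℝ} (hγ : γ ∈ Ioo (0 : ℝ) 1)
    (hp : 2 ≤ p) (hb : b ≠ 0) (hbp : |b| ≤ p / 2) :
    ∀ᶠ R in atTop, ‖∫ x in 0..R, oscIntegrand γ p b x‖ ≤
      lowFreqConst γ / 2 * (p ^ (γ - 1) * √p * |b| ^ (-γ)) := by
  have h1 := hγ.1
  have h2 : 0 < 1 - γ := by linarith [hγ.2]
  have hp0 : 0 < p := by linarith
  have hc : lowFreqConst γ / 2 = 116 + π + 1 / γ + 1 / (1 - γ) := by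
    rw [lowFreqConst]; ring
  have hπ := Real.pi_pos
  have i1 : 0 < 1 / γ := by positivity
  have i2 : 0 < 1 / (1 - γ) := by positivity
  rcases hb.lt_or_gt with hneg | hpos
  · rw [abs_of_neg hneg] at hbp ⊢
    filter_upwards [eventually_ge_atTop √(p / (-b) - 1)] with R hR
    have key := norm_integral_oscIntegrand_neg_le hγ hp0 (neg_pos.2 hneg) (by linarith) hR
    rw [neg_neg] at key
    refine key.trans ?_
    have hsq : 1 ≤ √p := Real.one_le_sqrt.2 (by linarith)
    have hb0 : 0 ≤ -b := by linarith
    have : p ^ (γ - 1) ≤ p ^ (γ - 1) * √p := le_mul_of_one_le_right (by positivity) hsq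
    rw [hc]
    gcongr
    linarith
  · rw [abs_of_pos hpos] at hbp ⊢
    filter_upwards [eventually_ge_atTop (2 * √(p / b - 1))] with R hR
    refine (norm_integral_oscIntegrand_pos_le hγ hp hpos hbp hR).trans ?_
    rw [hc]
    gcongr
    linarith

theorem eventually_norm_integral_oscIntegrand_zero_le {γ b : ℝ} (hγ : γ ∈ Ioo (0 : ℝ) 1)
    (hb : b ≠ 0) (hb1 : |b| ≤ 1) :
    ∀ᶠ R in atTop, ‖∫ x in 0..R, oscIntegrand γ 0 b x‖ ≤ lowFreqConst γ * |b| ^ (-γ) := by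
  have h1 := hγ.1
  have h2 : 0 < 1 - γ := by linarith [hγ.2]
  have hπ := Real.pi_pos
  have i1 : 0 < 1 / γ := by positivity
  have i2 : 0 < 1 / (1 - γ) := by positivity
  have hc : lowFreqConst γ = 232 + 2 * π + 2 * (1 / γ) + 2 * (1 / (1 - γ)) := by
    rw [lowFreqConst]; ring
  have hb0 : 0 < |b| := abs_pos.2 hb
  filter_upwards [eventually_ge_atTop √(1 / |b| - 1)] with R hR
  have key := norm_integral_oscIntegrand_zero_le hγ hb0 hb1 hR
  have hle : (1 / γ + π + (2 + 1 / (1 - γ))) * |b| ^ (-γ) ≤ lowFreqConst γ * |b| ^ (-γ) := by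
    rw [hc]
    refine mul_le_mul_of_nonneg_right ?_ (by positivity)
    linarith
  refine le_trans (le_of_eq ?_) (key.trans hle)
  rcases hb.lt_or_gt with hneg | hpos
  · rw [abs_of_neg hneg, neg_neg]
  · rw [abs_of_pos hpos, ← norm_integral_oscIntegrand_neg_neg, neg_zero]

theorem eventually_norm_integral_oscIntegrand_int_le {γ b : ℝ} (hγ : γ ∈ Ioo (0 : ℝ) 1) (m : ℤ)
    (hb : b ≠ 0) (hbm : |b| ≤ (1 + |(m : ℝ)|) / 2) :
    ∀ᶠ R in atTop, ‖∫ x in 0..R, oscIntegrand γ (2 * m) b x‖ ≤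
      lowFreqConst γ * ((1 + |(m : ℝ)|) ^ (γ - 1) * √(1 + |(m : ℝ)|) * |b| ^ (-γ)) := by
  wlog hm : 0 ≤ m generalizing m b
  · have := this (b := -b) (-m) (neg_ne_zero.2 hb) (by rwa [abs_neg, Int.cast_neg, abs_neg])
      (by omega)
    rw [Int.cast_neg, abs_neg, abs_neg] at this
    filter_upwards [this] with R hR
    rwa [mul_neg, norm_integral_oscIntegrand_neg_neg] at hR
  rcases hm.eq_or_lt with h0 | hpos
  · have hb1 : |b| ≤ 1 := by
      rw [← h0] at hbm; norm_num at hbm; linarith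
    simpa [← h0] using eventually_norm_integral_oscIntegrand_zero_le hγ hb hb1
  · have hm1 : (1 : ℝ) ≤ m := by exact_mod_cast hpos
    rw [abs_of_nonneg (a := (m : ℝ)) (by linarith)] at hbm ⊢
    filter_upwards [eventually_norm_integral_oscIntegrand_le_of_two_le hγ
      (by linarith : (2 : ℝ) ≤ 2 * m) hb (by linarith)] with R hR
    refine hR.trans ?_
    have hb0 : 0 ≤ |b| := abs_nonneg b
    have e1 : (2 * (m : ℝ)) ^ (γ - 1) ≤ (1 + m) ^ (γ - 1) :=
      Real.rpow_le_rpow_of_nonpos (by linarith) (by linarith) (by linarith [hγ.2])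
    have e2 : √(2 * (m : ℝ)) ≤ 2 * √(1 + (m : ℝ)) := by
      rw [Real.sqrt_le_left (by positivity), mul_pow, Real.sq_sqrt (by linarith)]; linarith
    have hL := (lowFreqConst_pos hγ).le
    calc _ ≤ lowFreqConst γ / 2 * ((1 + m) ^ (γ - 1) * (2 * √(1 + (m : ℝ))) * |b| ^ (-γ)) := by
          gcongr
      _ = _ := by ring

theorem norm_integral_symm_oscIntegrand_le (γ p b R : ℝ) :
    ‖∫ x in (-R)..R, oscIntegrand γ p b x‖ ≤ 2 * ‖∫ x in 0..R, oscIntegrand γ p b x‖ := by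
  have hc := continuous_oscIntegrand γ p b
  rw [← intervalIntegral.integral_add_adjacent_intervals (hc.intervalIntegrable (-R) 0)
    (hc.intervalIntegrable 0 R)]
  have h1 : ‖∫ x in (-R)..0, oscIntegrand γ p b x‖ = ‖∫ x in 0..R, oscIntegrand γ p b x‖ := by
    have := intervalIntegral.integral_comp_neg (a := 0) (b := R) (oscIntegrand γ p b)
    rw [neg_zero] at this
    rw [← this, ← norm_integral_oscIntegrand_neg_neg]
    simp_rw [oscIntegrand_neg_right, oscIntegrand_neg_neg]
  refine (norm_add_le _ _).trans (le_of_eq ?_)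
  rw [h1]; ring

theorem norm_le_of_isImpFT_vEven {u : ℝ} (hu : u ∈ Ioo (-1 : ℝ) 1) (m : ℤ) {ξ : ℝ} {z : ℂ}
    (hξ : ξ ≠ 0) (hξm : |2 * π * ξ| ≤ (1 + |(m : ℝ)|) / 2) (hz : IsImpFT (vEven u m) ξ z) :
    ‖z‖ ≤ 2 * (lowFreqConst ((1 - u) / 2) * ((1 + |(m : ℝ)|) ^ ((1 - u) / 2 - 1) *
      √(1 + |(m : ℝ)|) * |2 * π * ξ| ^ (-((1 - u) / 2)))) := by
  have hγ : (1 - u) / 2 ∈ Ioo (0 : ℝ) 1 := ⟨by linarith [hu.2], by linarith [hu.1]⟩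
  have hb : 2 * π * ξ ≠ 0 := by positivity
  refine le_of_tendsto hz.norm ?_
  filter_upwards [eventually_norm_integral_oscIntegrand_int_le hγ m hb hξm,
    eventually_ge_atTop 0] with R hR hR0
  have heq : ∀ x : ℝ, vEven u m x * cexp (-2 * (π : ℂ) * Complex.I * x * ξ) =
      oscIntegrand ((1 - u) / 2) (2 * m) (2 * π * ξ) x := by
    intro x
    rw [vEven_eq, oscIntegrand, mul_assoc, ← Complex.exp_add]
    congr 2
    · congr 2; ring
    · push_cast; ring
  simp_rw [heq]
  rw [← intervalIntegral.integral_of_le (by linarith)]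
  refine (norm_integral_symm_oscIntegrand_le _ _ _ _).trans ?_
  gcongr

theorem norm_sq_le_of_isImpFT_vEven {u : ℝ} (hu : u ∈ Ioo (-1 : ℝ) 1) (m : ℤ) {ξ : ℝ} {z : ℂ}
    (hξ : ξ ≠ 0) (hξm : |2 * π * ξ| ≤ (1 + |(m : ℝ)|) / 2) (hz : IsImpFT (vEven u m) ξ z) :
    ‖z‖ ^ 2 ≤ 4 * lowFreqConst ((1 - u) / 2) ^ 2 *
      ((1 + |(m : ℝ)|) ^ (-u) * |ξ| ^ (u - 1)) := by
  have hM : 0 < 1 + |(m : ℝ)| := by positivity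
  have hξ0 : 0 < |ξ| := abs_pos.2 hξ
  have hb : 0 < |2 * π * ξ| := by positivity
  have h := pow_le_pow_left₀ (norm_nonneg _) (norm_le_of_isImpFT_vEven hu m hξ hξm hz) 2
  have e1 : ((1 + |(m : ℝ)|) ^ ((1 - u) / 2 - 1)) ^ 2 * √(1 + |(m : ℝ)|) ^ 2 =
      (1 + |(m : ℝ)|) ^ (-u) := by
    rw [Real.sq_sqrt hM.le, ← Real.rpow_mul_natCast hM.le]
    nth_rw 2 [← Real.rpow_one (1 + |(m : ℝ)|)]
    rw [← Real.rpow_add hM]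
    congr 1; push_cast; ring
  have e2 : (|2 * π * ξ| ^ (-((1 - u) / 2))) ^ 2 = |2 * π * ξ| ^ (u - 1) := by
    rw [← Real.rpow_mul_natCast hb.le]
    congr 1; push_cast; ring
  have e3 : |2 * π * ξ| ^ (u - 1) ≤ |ξ| ^ (u - 1) := by
    refine Real.rpow_le_rpow_of_nonpos hξ0 ?_ (by linarith [hu.2])
    rw [abs_mul, abs_of_pos Real.two_pi_pos]
    nlinarith [Real.pi_gt_three]
  calc ‖z‖ ^ 2 ≤ _ := h
    _ = 4 * lowFreqConst ((1 - u) / 2) ^ 2 *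
        ((((1 + |(m : ℝ)|) ^ ((1 - u) / 2 - 1)) ^ 2 * √(1 + |(m : ℝ)|) ^ 2) *
          (|2 * π * ξ| ^ (-((1 - u) / 2))) ^ 2) := by ring
    _ ≤ _ := by rw [e1, e2]; gcongr

theorem lintegral_indicator_abs_rpow {r T : ℝ} (hr : -1 < r) (hT : 0 < T) :
    ∫⁻ x : ℝ, ENNReal.ofReal ((Iic T).indicator (fun y => y ^ r) |x|) =
      ENNReal.ofReal (2 * (T ^ (r + 1) / (r + 1))) := by
  have hint : ∫ x in Ioi (0 : ℝ), (Iic T).indicator (fun y => y ^ r) x = T ^ (r + 1) / (r + 1) := by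
    rw [setIntegral_indicator measurableSet_Iic, Ioi_inter_Iic, ← intervalIntegral.integral_of_le hT.le,
      integral_rpow (Or.inl hr), Real.zero_rpow (by linarith), sub_zero]
  have hr1 : 0 < r + 1 := by linarith
  have hval : ∫ x : ℝ, (Iic T).indicator (fun y => y ^ r) |x| = 2 * (T ^ (r + 1) / (r + 1)) := by
    rw [integral_comp_abs, hint]
  have hi : Integrable fun x : ℝ => (Iic T).indicator (fun y => y ^ r) |x| := by
    by_contra h
    rw [integral_undef h] at hval
    have : 0 < 2 * (T ^ (r + 1) / (r + 1)) := by positivity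
    linarith
  rw [← hval, ofReal_integral_eq_lintegral_ofReal hi (Eventually.of_forall fun x => ?_)]
  exact indicator_apply_nonneg (f := fun y : ℝ => y ^ r) fun _ => by positivity

open scoped FourierTransform in
theorem enorm_weight_le {u μ : ℝ} (hu : u ∈ Ioo (-1 : ℝ) 1) (hμ₁ : -1 - u < μ) (m : ℤ) {ξ : ℝ}
    (hξ : ξ ≠ 0) :
    ENNReal.ofReal (|ξ| ^ (-u - μ)) *
        ‖𝓕 (vEvenDeriv u m) ξ / (2 * π * Complex.I * ξ)‖ₑ ^ 2 ≤
      ENNReal.ofReal (4 * lowFreqConst ((1 - u) / 2) ^ 2 * (1 + |(m : ℝ)|) ^ (-u)) *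
        ENNReal.ofReal ((Iic ((1 + |(m : ℝ)|) / (4 * π))).indicator (fun y => y ^ (-μ - 1)) |ξ|) +
      ENNReal.ofReal (((1 + |(m : ℝ)|) / (4 * π)) ^ (-u - μ - 2)) *
        ‖𝓕 (vEvenDeriv u m) ξ‖ₑ ^ 2 := by
  have hξ0 : 0 < |ξ| := abs_pos.2 hξ
  set T := (1 + |(m : ℝ)|) / (4 * π) with hT
  have hT0 : 0 < T := by positivity
  by_cases h : |ξ| ≤ T
  · refine le_trans ?_ le_self_add
    have hξm : |2 * π * ξ| ≤ (1 + |(m : ℝ)|) / 2 := by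
      rw [hT, le_div_iff₀ (by positivity)] at h
      rw [abs_mul, abs_of_pos Real.two_pi_pos]; linarith
    have key := norm_sq_le_of_isImpFT_vEven hu m hξ hξm (isImpFT_vEven hu m hξ)
    rw [indicator_of_mem (mem_Iic.2 h), ← ofReal_norm, ← ENNReal.ofReal_pow (norm_nonneg _),
      ← ENNReal.ofReal_mul (by positivity), ← ENNReal.ofReal_mul (by positivity)]
    refine ENNReal.ofReal_le_ofReal ?_
    have e : |ξ| ^ (-μ - 1) = |ξ| ^ (-u - μ) * |ξ| ^ (u - 1) := by
      rw [← Real.rpow_add hξ0]; congr 1; ring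
    rw [e]
    refine (mul_le_mul_of_nonneg_left key (by positivity)).trans (le_of_eq ?_)
    ring
  · refine le_trans ?_ le_add_self
    push Not at h
    rw [← ofReal_norm, ← ofReal_norm, ← ENNReal.ofReal_pow (norm_nonneg _),
      ← ENNReal.ofReal_pow (norm_nonneg _), ← ENNReal.ofReal_mul (by positivity),
      ← ENNReal.ofReal_mul (by positivity)]
    refine ENNReal.ofReal_le_ofReal ?_
    have hn : ‖(2 * π * Complex.I * ξ : ℂ)‖ = 2 * π * |ξ| := by
      simp [abs_of_pos Real.pi_pos]
    have e : |ξ| ^ (-u - μ) = |ξ| ^ (-u - μ - 2) * |ξ| ^ 2 := by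
      rw [← Real.rpow_natCast, ← Real.rpow_add hξ0]; congr 1; push_cast; ring
    have hle : |ξ| ^ (-u - μ - 2) ≤ T ^ (-u - μ - 2) :=
      Real.rpow_le_rpow_of_nonpos hT0 h.le (by linarith)
    rw [norm_div, hn, div_pow, mul_pow, e]
    have hπ : 1 ≤ (2 * π) ^ 2 := by nlinarith [Real.pi_gt_three]
    calc _ = |ξ| ^ (-u - μ - 2) * (‖𝓕 (vEvenDeriv u m) ξ‖ ^ 2 / (2 * π) ^ 2) := by field_simp
      _ ≤ _ := by
        gcongr
        exact div_le_self (by positivity) hπ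

open scoped FourierTransform in
theorem lintegral_weight_le {u μ : ℝ} (hu : u ∈ Ioo (-1 : ℝ) 1) (hμ₁ : -1 - u < μ) (hμ₂ : μ < 0)
    (m : ℤ) :
    ∫⁻ ξ : ℝ, ENNReal.ofReal (|ξ| ^ (-u - μ)) *
        ‖𝓕 (vEvenDeriv u m) ξ / (2 * π * Complex.I * ξ)‖ₑ ^ 2 ≤
      ENNReal.ofReal ((8 * lowFreqConst ((1 - u) / 2) ^ 2 / ((4 * π) ^ (-μ) * -μ) +
        4 * (4 * π) ^ (u + μ + 2) * ∫ x : ℝ, (1 + x ^ 2) ^ (-(2 * (2 + u)) / 2)) *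
          (1 + |(m : ℝ)|) ^ (-u - μ)) := by
  have hM : 0 < 1 + |(m : ℝ)| := by positivity
  have hK : 0 ≤ ∫ x : ℝ, (1 + x ^ 2) ^ (-(2 * (2 + u)) / 2) :=
    integral_nonneg fun x => by positivity
  have hμ : 0 < -μ := by linarith
  have hmeas : Measurable fun ξ : ℝ =>
      ENNReal.ofReal (4 * lowFreqConst ((1 - u) / 2) ^ 2 * (1 + |(m : ℝ)|) ^ (-u)) *
        ENNReal.ofReal ((Iic ((1 + |(m : ℝ)|) / (4 * π))).indicator (fun y => y ^ (-μ - 1)) |ξ|) := by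
    refine (ENNReal.measurable_ofReal.comp ?_).const_mul _
    exact ((measurable_id.pow_const _).indicator measurableSet_Iic).comp measurable_norm
  have hne : ∀ᵐ ξ : ℝ, ξ ≠ 0 := measure_mono_null (by simp) (measure_singleton (0 : ℝ))
  refine (lintegral_mono_ae (hne.mono fun ξ hξ => enorm_weight_le hu hμ₁ m hξ)).trans ?_
  rw [lintegral_add_left hmeas, lintegral_const_mul' _ _ ENNReal.ofReal_ne_top,
    lintegral_const_mul' _ _ ENNReal.ofReal_ne_top,
    lintegral_indicator_abs_rpow (by linarith) (by positivity),
    lintegral_enorm_sq_fourier_eq (integrable_vEvenDeriv hu m) (memLp_vEvenDeriv hu m)]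
  refine (add_le_add le_rfl (mul_le_mul_right (lintegral_enorm_sq_vEvenDeriv_le hu m) _)).trans ?_
  rw [← ENNReal.ofReal_mul (by positivity), ← ENNReal.ofReal_mul (by positivity),
    sub_add_cancel, ← ENNReal.ofReal_add (by positivity) (by positivity)]
  refine ENNReal.ofReal_le_ofReal (le_of_eq ?_)
  have e1 : (1 + |(m : ℝ)|) ^ (-u - μ) = (1 + |(m : ℝ)|) ^ (-u) * (1 + |(m : ℝ)|) ^ (-μ) := by
    rw [← Real.rpow_add hM]; rfl
  have e2 : (1 + |(m : ℝ)|) ^ (-u - μ) = (1 + |(m : ℝ)|) ^ (-u - μ - 2) * (1 + |(m : ℝ)|) ^ 2 := by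
    rw [← Real.rpow_natCast, ← Real.rpow_add hM]; congr 1; push_cast; ring
  have e3 : (4 * π) ^ (u + μ + 2) = ((4 * π) ^ (-u - μ - 2))⁻¹ := by
    rw [← Real.rpow_neg (by positivity)]; congr 1; ring
  have h4 : (0 : ℝ) ≤ 4 * π := by positivity
  rw [add_mul, Real.div_rpow hM.le h4, Real.div_rpow hM.le h4]
  congr 1
  · rw [e1]; field_simp; ring
  · rw [e2, e3]; field_simp; norm_num

/-- for `u ∈ (−1,1)` and `μ ∈ (−1−u, 0)`, the K-averaged norm
`⫴v_{2m}^{(u)}⫴²_{u+μ} = ∫₀^{2π} ∫ |ξ|^{−u−μ} |𝓕(π_{u,+}(k_θ)v_{2m}^{(u)})(ξ)|² dξ dθ`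
is bounded by `c_{μ,u} (1+|m|)^{−u−μ}`, the improper Fourier transforms existing for
`ξ ≠ 0`. -/
theorem stmt18 (u μ : ℝ) (hu : u ∈ Set.Ioo (-1 : ℝ) 1) (hμ₁ : -1 - u < μ) (hμ₂ : μ < 0) :
    ∃ c : ℝ, 0 < c ∧
      ∀ m : ℤ, ∃ F : ℝ → ℝ → ℂ,
        (∀ θ : ℝ, ∀ ξ : ℝ, ξ ≠ 0 →
          IsImpFT (piPlus (u : ℂ) θ (vEven (u : ℂ) m)) ξ (F θ ξ)) ∧
        (∫⁻ θ in Ioc (0:ℝ) (2 * π),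
            ∫⁻ ξ : ℝ, ENNReal.ofReal (|ξ| ^ (-u - μ)) * (‖F θ ξ‖₊ : ℝ≥0∞) ^ 2)
          ≤ ENNReal.ofReal (c * (1 + |(m : ℝ)|) ^ (-u - μ)) := by
  refine ⟨2 * π * (8 * lowFreqConst ((1 - u) / 2) ^ 2 / ((4 * π) ^ (-μ) * -μ) +
    4 * (4 * π) ^ (u + μ + 2) * ∫ x : ℝ, (1 + x ^ 2) ^ (-(2 * (2 + u)) / 2)), ?_, fun m =>
    ⟨fun θ ξ => cexp ((2 * m * θ : ℝ) * Complex.I) *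
      (FourierTransform.fourier (vEvenDeriv u m) ξ / (2 * π * Complex.I * ξ)), fun θ ξ hξ => ?_, ?_⟩⟩
  · have hL := lowFreqConst_pos (γ := (1 - u) / 2) ⟨by linarith [hu.2], by linarith [hu.1]⟩
    have hK : 0 ≤ ∫ x : ℝ, (1 + x ^ 2) ^ (-(2 * (2 + u)) / 2) :=
      integral_nonneg fun x => by positivity
    have hμ : 0 < -μ := by linarith
    positivity
  · exact ((isImpFT_vEven hu m hξ).const_mul _).congr_ae (piPlus_vEven_ae u θ m)
  · have hnorm : ∀ (θ : ℝ) (z : ℂ), ((‖cexp ((2 * m * θ : ℝ) * Complex.I) * z‖₊ : ℝ≥0) : ℝ≥0∞) =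
        ‖z‖ₑ := by
      intro θ z
      rw [← enorm_eq_nnnorm, enorm_mul, ← ofReal_norm, Complex.norm_exp_ofReal_mul_I,
        ENNReal.ofReal_one, one_mul]
    simp_rw [hnorm]
    rw [setLIntegral_const, Real.volume_Ioc, sub_zero, mul_comm]
    refine (mul_le_mul_right (lintegral_weight_le hu hμ₁ hμ₂ m) _).trans (le_of_eq ?_)
    rw [← ENNReal.ofReal_mul Real.two_pi_pos.le, mul_assoc (2 * π)]
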